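/- arXiv:1607.01117 — 2 statements merged into one kernel-verified Lean document; each statement's English description precedes it below -/
import Mathlib

section
/- For every integer h ≥ 2, the complete (h−1)^h-ary tree T of height h satisfies φ(T) ≥ h: it has no anagram-free vertex colouring using at most h − 1 colours. -/
/-- A word is an *anagram* if it has the form `w₁ ++ w₂` where `w₁` is non-empty
and `w₂` is a permutation of `w₁`. -/
def IsAnagram {α : Type*} (l : List α) : Prop :=
  ∃ w₁ w₂ : List α, w₁ ≠ [] ∧ List.Perm w₁ w₂ ∧ l = w₁ ++ w₂

/-- A word is a *`k`-anagram* if it is a concatenation of `k` permutations of a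
fixed non-empty word `W`. -/
def IsKAnagram {α : Type*} (k : ℕ) (l : List α) : Prop :=
  ∃ (W : List α) (ws : List (List α)), W ≠ [] ∧ ws.length = k ∧
    (∀ w ∈ ws, List.Perm w W) ∧ l = ws.flatten

/-- A vertex colouring `f` of a graph `G` is *anagram-free* if the colour
sequence on the vertices of every path of `G` is not an anagram. -/
def AnagramFreeVC {V C : Type*} (G : SimpleGraph V) (f : V → C) : Prop :=
  ∀ ⦃u v : V⦄ (p : G.Walk u v), p.IsPath → ¬ IsAnagram (p.support.map f)

/-- An edge colouring `f` of a graph `G` is *anagram-free* if the colour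
sequence on the edges of every path of `G` is not an anagram. -/
def AnagramFreeEC {V C : Type*} (G : SimpleGraph V) (f : Sym2 V → C) : Prop :=
  ∀ ⦃u v : V⦄ (p : G.Walk u v), p.IsPath → ¬ IsAnagram (p.edges.map f)

/-- A vertex colouring `f` of a graph `G` is *`k`-anagram-free* if the colour
sequence on the vertices of every path of `G` is not a `k`-anagram. -/
def KAnagramFreeVC {V C : Type*} (k : ℕ) (G : SimpleGraph V) (f : V → C) : Prop :=
  ∀ ⦃u v : V⦄ (p : G.Walk u v), p.IsPath → ¬ IsKAnagram k (p.support.map f)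

/-- An edge colouring `f` of a graph `G` is *`k`-anagram-free* if the colour
sequence on the edges of every path of `G` is not a `k`-anagram. -/
def KAnagramFreeEC {V C : Type*} (k : ℕ) (G : SimpleGraph V) (f : Sym2 V → C) : Prop :=
  ∀ ⦃u v : V⦄ (p : G.Walk u v), p.IsPath → ¬ IsKAnagram k (p.edges.map f)

/-- The vertex set of the complete `d`-ary tree of height `h`: sequences of
branching choices of length at most `h` (the root is the empty list and the
leaves are the lists of length exactly `h`). -/
abbrev daryVertex (d h : ℕ) : Type := {l : List (Fin d) // l.length ≤ h}

/-- The complete `d`-ary tree of height `h`: every internal vertex has `d`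
children and every leaf is at distance `h` from the root. -/
def daryTree (d h : ℕ) : SimpleGraph (daryVertex d h) :=
  SimpleGraph.fromRel (fun x y => ∃ a : Fin d, y.1 = a :: x.1)

/-- `HasPathDecomp G w` means `G` has a path decomposition of width at most `w`:
a sequence of bags covering all vertices and edges, where the bags containing a
fixed vertex form a contiguous interval and each bag has at most `w + 1`
vertices.  Thus `HasPathDecomp G w` says that the pathwidth of `G` is at
most `w`. -/
def HasPathDecomp {V : Type*} (G : SimpleGraph V) (w : ℕ) : Prop :=
  ∃ (n : ℕ) (B : Fin n → Finset V),
    (∀ v : V, ∃ i, v ∈ B i) ∧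
    (∀ ⦃u v : V⦄, G.Adj u v → ∃ i, u ∈ B i ∧ v ∈ B i) ∧
    (∀ (v : V) (i j k : Fin n), i ≤ j → j ≤ k → v ∈ B i → v ∈ B k → v ∈ B j) ∧
    (∀ i, (B i).card ≤ w + 1)

/-- `v` is the root of a levelwise coloured branching subtree with level colours `t`. -/
def DaryGood {d h : ℕ} {C : Type} (f : daryVertex d h → C) : List (Fin d) → List C → Prop
  | _, [] => True
  | v, a :: t => (∃ hv : v.length ≤ h, f ⟨v, hv⟩ = a) ∧
      ∃ x y : Fin d, x ≠ y ∧ DaryGood f (x :: v) t ∧ DaryGood f (y :: v) t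

theorem dary_walk_of_chain {V : Type*} (G : SimpleGraph V) :
    ∀ (l : List V) (u : V), List.IsChain G.Adj (u :: l) →
      ∃ (v : V) (p : G.Walk u v), p.support = u :: l
  | [], u, _ => ⟨u, SimpleGraph.Walk.nil, rfl⟩
  | w :: l, u, hc => by
    rw [List.isChain_cons_cons] at hc
    obtain ⟨v, p, hp⟩ := dary_walk_of_chain G l w hc.2
    exact ⟨v, SimpleGraph.Walk.cons hc.1 p, by simp [hp]⟩

theorem dary_not_anagram {V C : Type*} {G : SimpleGraph V} {f : V → C} (hf : AnagramFreeVC G f)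
    (l : List V) (hc : List.IsChain G.Adj l) (hn : l.Nodup) : ¬ IsAnagram (l.map f) := by
  cases l with
  | nil =>
    rintro ⟨w₁, w₂, h1, -, h3⟩
    simp at h3
    exact h1 h3.1
  | cons u l =>
    obtain ⟨v, p, hp⟩ := dary_walk_of_chain G l u hc
    have := hf p (by rw [SimpleGraph.Walk.isPath_def, hp]; exact hn)
    rwa [hp] at this

theorem dary_adj {d h : ℕ} (v : List (Fin d)) (x : Fin d) (hv : v.length ≤ h)
    (w : daryVertex d h) (hw : w.1 = x :: v) : (daryTree d h).Adj ⟨v, hv⟩ w := by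
  rw [daryTree, SimpleGraph.fromRel_adj]
  refine ⟨?_, Or.inl ⟨x, hw⟩⟩
  rintro rfl
  have := congrArg List.length hw
  simp at this

theorem dary_down {d h : ℕ} {C : Type} (f : daryVertex d h → C) (t : List C) :
    ∀ (s : List C) (v : List (Fin d)), DaryGood f v (s ++ t) →
      ∃ L : List (daryVertex d h), L.map f = s ∧ List.IsChain (daryTree d h).Adj L ∧ L.Nodup ∧
        (∀ x ∈ L, v <:+ x.1) ∧ ∀ x ∈ L.head?, x.1 = v
  | [], v, _ => ⟨[], by simp⟩
  | a :: s, v, hg => by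
    obtain ⟨⟨hv, hfa⟩, x, -, -, hx, -⟩ := hg
    obtain ⟨L, h1, h2, h3, h4, h5⟩ := dary_down f t s (x :: v) hx
    refine ⟨⟨v, hv⟩ :: L, by simp [h1, hfa], ?_, ?_, ?_, by simp⟩
    · rw [List.isChain_cons]
      exact ⟨fun y hy => dary_adj v x hv y (h5 y hy), h2⟩
    · rw [List.nodup_cons]
      refine ⟨fun hm => ?_, h3⟩
      have := (h4 _ hm).length_le
      simp at this
    · intro y hy
      rcases List.mem_cons.1 hy with rfl | hy
      · exact List.suffix_refl _
      · exact (List.suffix_cons x v).trans (h4 y hy)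

theorem dary_anagram {d h : ℕ} {C : Type} (f : daryVertex d h → C)
    (hf : AnagramFreeVC (daryTree d h) f) (a : C) (m q : List C) (v : List (Fin d))
    (hg : DaryGood f v (a :: (m ++ a :: q))) : False := by
  obtain ⟨⟨hv, hfa⟩, x, y, hxy, hx, hy⟩ := hg
  obtain ⟨L, h1, h2, h3, h4, h5⟩ := dary_down f (a :: q) m (x :: v) hx
  obtain ⟨M, k1, k2, k3, k4, k5⟩ := dary_down f q (m ++ [a]) (y :: v) (by simpa using hy)
  have nv : ∀ (z : Fin d) (N : List (daryVertex d h)), (∀ w ∈ N, (z :: v) <:+ w.1) →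
      (⟨v, hv⟩ : daryVertex d h) ∉ N := by
    intro z N hN hm
    have := (hN _ hm).length_le
    simp at this
  refine dary_not_anagram hf (L.reverse ++ ⟨v, hv⟩ :: M) ?_ ?_ ?_
  · rw [List.isChain_append]
    refine ⟨?_, ?_, ?_⟩
    · rw [List.isChain_reverse]
      exact h2.imp fun _ _ h => h.symm
    · rw [List.isChain_cons]
      exact ⟨fun w hw => dary_adj v y hv w (k5 w hw), k2⟩
    · intro w hw z hz
      simp at hz
      subst hz
      rw [List.getLast?_reverse] at hw
      exact (dary_adj v x hv w (h5 w hw)).symm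
  · rw [List.nodup_append]
    refine ⟨List.nodup_reverse.2 h3, List.nodup_cons.2 ⟨nv y M k4, k3⟩, ?_⟩
    intro w hw z hz hwz
    subst hwz
    rw [List.mem_reverse] at hw
    rcases List.mem_cons.1 hz with rfl | hz
    · exact nv x L h4 hw
    · have := List.suffix_of_suffix_length_le (h4 _ hw) (k4 _ hz) (by simp)
      have := this.eq_of_length (by simp)
      simp at this
      exact hxy this
  · refine ⟨m.reverse ++ [a], m ++ [a], by simp, (List.reverse_perm m).append_right _, ?_⟩
    simp [h1, k1, hfa]

theorem dary_nodup {d h : ℕ} {C : Type} (f : daryVertex d h → C)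
    (hf : AnagramFreeVC (daryTree d h) f) :
    ∀ (t : List C) (v : List (Fin d)), DaryGood f v t → t.Nodup
  | [], _, _ => List.nodup_nil
  | a :: t, v, hg => by
    rw [List.nodup_cons]
    refine ⟨fun hm => ?_, ?_⟩
    · obtain ⟨m, q, rfl⟩ := List.append_of_mem hm
      exact dary_anagram f hf a m q v hg
    · obtain ⟨-, x, -, -, hx, -⟩ := hg
      exact dary_nodup f hf t (x :: v) hx

theorem dary_exists {d h c : ℕ} (hc : 1 ≤ c) (f : daryVertex d h → Fin c) :
    ∀ (n : ℕ) (v : List (Fin d)), c ^ (n - 1) < d → v.length + n ≤ h + 1 →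
      ∃ t : List (Fin c), t.length = n ∧ DaryGood f v t
  | 0, _, _, _ => ⟨[], rfl, trivial⟩
  | n + 1, v, hd, hn => by
    have hd' : c ^ (n - 1) < d :=
      lt_of_le_of_lt (Nat.pow_le_pow_right hc (by omega)) hd
    have ih : ∀ x : Fin d, ∃ t : List.Vector (Fin c) n, DaryGood f (x :: v) t.1 := by
      intro x
      obtain ⟨t, h1, h2⟩ := dary_exists hc f n (x :: v) hd' (by simp; omega)
      exact ⟨⟨t, h1⟩, h2⟩
    choose T hT using ih
    obtain ⟨x, y, hxy, hT'⟩ := Fintype.exists_ne_map_eq_of_card_lt T (by simpa using hd)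
    have hv : v.length ≤ h := by omega
    refine ⟨f ⟨v, hv⟩ :: (T x).1, by simp [(T x).2], ⟨hv, rfl⟩, x, y, hxy, hT x, ?_⟩
    rw [hT']
    exact hT y

/-- For every `h ≥ 2`, the complete `(h-1)^h`-ary tree of
height `h` has no anagram-free vertex colouring with at most `h - 1` colours,
i.e. `φ(T) ≥ h`. -/
theorem daryTree_anagramFree_chromatic_ge_height (h : ℕ) (hh : 2 ≤ h) :
    ∀ f : daryVertex ((h - 1) ^ h) h → Fin (h - 1),
      ¬ AnagramFreeVC (daryTree ((h - 1) ^ h) h) f := by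
  intro f hf
  rcases Nat.lt_or_ge 2 h with h2 | h2
  · obtain ⟨t, ht, hg⟩ := dary_exists (by omega) f h []
      (Nat.pow_lt_pow_right (by omega) (by omega)) (by simp)
    have := (dary_nodup f hf t [] hg).length_le_card
    simp at this
    omega
  · obtain rfl : h = 2 := by omega
    have hadj := dary_adj (d := (2 - 1) ^ 2) (h := 2) [] ⟨0, by norm_num⟩ (by simp)
      ⟨[⟨0, by norm_num⟩], by simp⟩ rfl
    refine dary_not_anagram hf [_, _] (List.isChain_pair.2 hadj) (by simp) ?_
    refine ⟨[f ⟨[], by simp⟩], [f ⟨[⟨0, by norm_num⟩], by simp⟩], by simp, ?_, rfl⟩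
    rw [List.singleton_perm_singleton]
    exact Subsingleton.elim (α := Fin 1) _ _
end

section
/- Every tree T satisfies φ'_6(T) ≤ 3 and φ'_8(T) ≤ 2: every tree has a 6-anagram-free edge colouring with 3 colours and an 8-anagram-free edge colouring with 2 colours. -/
/-- Parikh vector of a word. -/
def parikh {α : Type*} [DecidableEq α] (l : List α) : α → ℤ := fun a => (l.count a : ℤ)

/-- `l` has prefixes whose Parikh vectors form a nonconstant arithmetic progression of
`k + 1` terms. -/
def HasAP {α : Type*} [DecidableEq α] (k : ℕ) (l : List α) : Prop :=
  ∃ (q : ℕ → List α) (d : α → ℤ), d ≠ 0 ∧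
    ∀ j ≤ k, q j <+: l ∧ parikh (q j) = parikh (q 0) + j • d

theorem parikh_append {α : Type*} [DecidableEq α] (l m : List α) :
    parikh (l ++ m) = parikh l + parikh m := by
  funext a; simp [parikh]

theorem parikh_nil {α : Type*} [DecidableEq α] : parikh ([] : List α) = 0 := by
  funext a; simp [parikh]

theorem parikh_ne_zero {α : Type*} [DecidableEq α] {l : List α} (hl : l ≠ []) :
    parikh l ≠ 0 := by
  cases l with
  | nil => exact absurd rfl hl
  | cons a t =>
    intro h
    have := congrFun h a
    simp only [parikh, List.count_cons_self, Pi.zero_apply] at this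
    omega

theorem parikh_perm {α : Type*} [DecidableEq α] {l m : List α} (h : l.Perm m) :
    parikh l = parikh m := by
  funext a; simp [parikh, h.count_eq]

theorem parikh_flatten_take {α : Type*} [DecidableEq α] (W : List α) :
    ∀ (ws : List (List α)), (∀ w ∈ ws, List.Perm w W) → ∀ j ≤ ws.length,
      parikh (ws.take j).flatten = j • parikh W := by
  intro ws
  induction ws with
  | nil => intro _ j hj; simp at hj; subst hj; simp [parikh_nil]
  | cons w ws ih =>
    intro hw j hj
    cases j with
    | zero => simp [parikh_nil]
    | succ j =>
      rw [List.take_succ_cons, List.flatten_cons, parikh_append,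
        ih (fun x hx => hw x (by simp [hx])) j (by simpa using hj), parikh_perm (hw w (by simp)),
        succ_nsmul, add_comm]

theorem hasAP_of_infix {α : Type*} [DecidableEq α] {k : ℕ} {l m : List α}
    (h : IsKAnagram k m) (hm : m <:+: l) : HasAP k l := by
  obtain ⟨W, ws, hW, hlen, hws, rfl⟩ := h
  obtain ⟨s, t, rfl⟩ := hm
  refine ⟨fun j => s ++ (ws.take j).flatten, parikh W, parikh_ne_zero hW, fun j hj => ⟨?_, ?_⟩⟩
  · refine ⟨(ws.drop j).flatten ++ t, ?_⟩
    conv_rhs => rw [← List.take_append_drop j ws]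
    simp only [List.flatten_append, List.append_assoc]
  · simp only [parikh_append, parikh_flatten_take W ws hws j (by omega)]
    simp [parikh_nil]

theorem isKAnagram_reverse {α : Type*} {k : ℕ} {m : List α}
    (h : IsKAnagram k m) : IsKAnagram k m.reverse := by
  obtain ⟨W, ws, hW, hlen, hws, rfl⟩ := h
  refine ⟨W, (ws.map List.reverse).reverse, hW, by simpa using hlen, ?_, ?_⟩
  · intro w hw
    simp only [List.mem_reverse, List.mem_map] at hw
    obtain ⟨x, hx, rfl⟩ := hw
    exact (List.reverse_perm x).trans (hws x hx)
  · rw [List.reverse_flatten]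

theorem isKAnagram_split {α : Type*} {k : ℕ} {R S : List α}
    (h : IsKAnagram (k + k) (R ++ S)) :
    (∃ m, IsKAnagram k m ∧ m <:+: R) ∨ (∃ m, IsKAnagram k m ∧ m <:+: S) := by
  obtain ⟨W, ws, hW, hlen, hws, he⟩ := h
  rw [← List.take_append_drop k ws, List.flatten_append] at he
  have h1 : IsKAnagram k (ws.take k).flatten :=
    ⟨W, ws.take k, hW, by simp [hlen], fun w hw => hws w (List.mem_of_mem_take hw), rfl⟩
  have h2 : IsKAnagram k (ws.drop k).flatten :=
    ⟨W, ws.drop k, hW, by simp [hlen], fun w hw => hws w (List.mem_of_mem_drop hw), rfl⟩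
  rcases List.append_eq_append_iff.1 he with ⟨t, _, ht⟩ | ⟨t, ht, _⟩
  · exact Or.inr ⟨_, h2, List.IsSuffix.isInfix ⟨t, ht.symm⟩⟩
  · exact Or.inl ⟨_, h1, List.IsPrefix.isInfix ⟨t, ht.symm⟩⟩

/-- Dekking's data for a morphism. -/
structure DekkingData (α : Type) [DecidableEq α] (k n : ℕ) (h : α → List α) where
  M : (α → ℤ) →+ (α → ℤ)
  F : (α → ℤ) →+ ZMod n
  c : ZMod n → α → ℤ
  M_inj : ∀ v, M v = 0 → v = 0
  M_h : ∀ a, M (parikh [a]) = parikh (h a)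
  F_h : ∀ a, F (parikh (h a)) = 0
  c_zero : c 0 = 0
  A : Finset (ZMod n)
  A_zero : 0 ∈ A
  A_pref : ∀ a, ∀ p ∈ (h a).inits, F (parikh p) ∈ A
  c_pref : ∀ a, ∀ p ∈ (h a).inits, parikh p = c (F (parikh p)) ∨
    parikh p = parikh (h a) + c (F (parikh p))
  A_ap : ∀ x d : ZMod n, (∀ j ≤ k, x + j • d ∈ A) → d = 0

theorem DekkingData.pref {α : Type} [DecidableEq α] {k n : ℕ} {h : α → List α}
    (D : DekkingData α k n h) : ∀ (l p : List α), p <+: l.flatMap h →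
      D.F (parikh p) ∈ D.A ∧ ∃ q, q <+: l ∧ parikh p = D.M (parikh q) + D.c (D.F (parikh p)) := by
  intro l
  induction l with
  | nil =>
    intro p hp
    simp at hp
    subst hp
    simp [parikh_nil, D.A_zero, D.c_zero]
  | cons a l ih =>
    intro p hp
    rw [List.flatMap_cons] at hp
    have hp2 : p <+: h a ∨ ∃ r, p = h a ++ r ∧ r <+: l.flatMap h := by
      obtain ⟨t, ht⟩ := hp
      rcases List.append_eq_append_iff.1 ht with ⟨s, h1, _⟩ | ⟨s, h1, h2⟩
      · exact Or.inl ⟨s, h1.symm⟩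
      · exact Or.inr ⟨s, h1, t, h2.symm⟩
    rcases hp2 with hp | ⟨r, rfl, hr⟩
    · have hp' : p ∈ (h a).inits := (List.mem_inits _ _).2 hp
      refine ⟨D.A_pref a p hp', ?_⟩
      rcases D.c_pref a p hp' with h1 | h1
      · exact ⟨[], by simp, by rw [parikh_nil, map_zero, zero_add]; exact h1⟩
      · exact ⟨[a], by simp, by rw [D.M_h]; exact h1⟩
    · obtain ⟨hA, q, hq, he⟩ := ih r hr
      have hF : D.F (parikh (h a ++ r)) = D.F (parikh r) := by
        rw [parikh_append, map_add, D.F_h, zero_add]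
      rw [hF]
      refine ⟨hA, a :: q, by simpa using hq, ?_⟩
      rw [parikh_append, show a :: q = [a] ++ q from rfl, parikh_append, map_add, D.M_h, add_assoc,
        ← he]

theorem DekkingData.step {α : Type} [DecidableEq α] {k n : ℕ} (hk : 1 ≤ k) {h : α → List α}
    (D : DekkingData α k n h) (l : List α) (hl : HasAP k (l.flatMap h)) : HasAP k l := by
  obtain ⟨q, d, hd, hq⟩ := hl
  have hFq : ∀ j ≤ k, D.F (parikh (q j)) = D.F (parikh (q 0)) + j • D.F d := by
    intro j hj
    rw [(hq j hj).2, map_add, map_nsmul]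
  have hd0 : D.F d = 0 := by
    apply D.A_ap (D.F (parikh (q 0)))
    intro j hj
    rw [← hFq j hj]
    exact (D.pref l _ (hq j hj).1).1
  have key : ∀ j, ∃ r, j ≤ k → r <+: l ∧
      parikh (q j) = D.M (parikh r) + D.c (D.F (parikh (q 0))) := by
    intro j
    by_cases hj : j ≤ k
    · obtain ⟨_, r, hr, he⟩ := D.pref l _ (hq j hj).1
      rw [hFq j hj, hd0, smul_zero, add_zero] at he
      exact ⟨r, fun _ => ⟨hr, he⟩⟩
    · exact ⟨[], fun h => absurd h hj⟩
  choose r hr using key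
  have hM : ∀ j ≤ k, D.M (parikh (r j) - parikh (r 0)) = j • d := by
    intro j hj
    have h1 := (hr j hj).2
    have h0 := (hr 0 (by omega)).2
    have h2 := (hq j hj).2
    generalize D.c (D.F (parikh (q 0))) = e at h0 h1
    rw [h1, h0] at h2
    rw [map_sub, sub_eq_iff_eq_add]
    have h3 : D.M (parikh (r j)) + e = (j • d + D.M (parikh (r 0))) + e := by
      rw [h2]; abel
    exact add_right_cancel h3
  refine ⟨r, parikh (r 1) - parikh (r 0), ?_, ?_⟩
  · intro h0
    have := hM 1 hk
    rw [h0, map_zero, one_smul] at this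
    exact hd this.symm
  · intro j hj
    refine ⟨(hr j hj).1, ?_⟩
    have : parikh (r j) - parikh (r 0) - j • (parikh (r 1) - parikh (r 0)) = 0 := by
      apply D.M_inj
      rw [map_sub, map_nsmul, hM j hj, hM 1 hk, one_smul, sub_self]
    rw [sub_sub, sub_eq_zero] at this
    exact this

theorem not_hasAP_singleton {α : Type} [DecidableEq α] {k : ℕ} (hk : 2 ≤ k) (a : α) :
    ¬ HasAP k [a] := by
  rintro ⟨q, d, hd, hq⟩
  apply hd
  funext b
  have hb : ∀ j ≤ k, 0 ≤ parikh (q j) b ∧ parikh (q j) b ≤ 1 := by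
    intro j hj
    have h1 := (hq j hj).1.sublist.count_le b
    have h2 := List.count_le_length (a := b) (l := [a])
    simp only [List.length_singleton] at h2
    simp only [parikh]
    omega
  have h0 := hb 0 (by omega)
  have h2 := hb 2 hk
  rw [(hq 2 hk).2] at h2
  rw [Pi.add_apply, Pi.smul_apply, nsmul_eq_mul] at h2
  simp only [Pi.zero_apply]
  push_cast at h2
  omega

theorem DekkingData.long {α : Type} [DecidableEq α] {k n : ℕ} (hk : 2 ≤ k) {h : α → List α}
    (D : DekkingData α k n h) (hlen : ∀ a, 2 ≤ (h a).length) (a : α) (N : ℕ) :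
    ∃ l : List α, N < l.length ∧ ¬ HasAP k l := by
  induction N with
  | zero => exact ⟨[a], by simp, not_hasAP_singleton hk a⟩
  | succ N ih =>
    obtain ⟨l, hl, hn⟩ := ih
    refine ⟨l.flatMap h, ?_, fun hh => hn (D.step (by omega) l hh)⟩
    have : ∀ l : List α, 2 * l.length ≤ (l.flatMap h).length := by
      intro l
      induction l with
      | nil => simp
      | cons b l ih =>
        have := hlen b
        simp only [List.flatMap_cons, List.length_append, List.length_cons]
        omega
    have := this l
    omega

/-- Dekking's ternary morphism. -/
def h3 : Fin 3 → List (Fin 3) := ![[0, 0, 1, 2], [1, 1, 2], [0, 2, 2]]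

/-- Dekking's binary morphism. -/
def h2 : Fin 2 → List (Fin 2) := ![[0, 1, 1], [0, 0, 0, 1]]

def dekking3 : DekkingData (Fin 3) 3 7 h3 where
  M := { toFun := fun v => ![2 * v 0 + v 2, v 0 + 2 * v 1, v 0 + v 1 + 2 * v 2]
         map_zero' := by decide
         map_add' := by
          intro v w; funext i; fin_cases i <;> simp <;> ring }
  F := { toFun := fun v => (v 0 : ZMod 7) + 2 * v 1 + 3 * v 2
         map_zero' := by simp
         map_add' := by intro v w; simp; ring }
  c := ![![0, 0, 0], ![1, 0, 0], ![0, -1, -1], 0, ![0, 0, -1], 0, 0]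
  M_inj := by
    intro v hv
    have h0 := congrFun hv 0
    have h1 := congrFun hv 1
    have h2 := congrFun hv 2
    simp at h0 h1 h2
    funext i
    fin_cases i <;> simp <;> omega
  M_h := by decide
  F_h := by decide
  c_zero := by decide
  A := {0, 1, 2, 4}
  A_zero := by decide
  A_pref := by decide
  c_pref := by decide
  A_ap := by decide

def dekking2 : DekkingData (Fin 2) 4 5 h2 where
  M := { toFun := fun v => ![v 0 + 3 * v 1, 2 * v 0 + v 1]
         map_zero' := by decide
         map_add' := by
          intro v w; funext i; fin_cases i <;> simp <;> ring }
  F := { toFun := fun v => (v 0 : ZMod 5) + 2 * v 1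
         map_zero' := by simp
         map_add' := by intro v w; simp; ring }
  c := ![![0, 0], ![1, 0], ![2, 0], ![0, -1], 0]
  M_inj := by
    intro v hv
    have h0 := congrFun hv 0
    have h1 := congrFun hv 1
    simp at h0 h1
    funext i
    fin_cases i <;> simp <;> omega
  M_h := by decide
  F_h := by decide
  c_zero := by decide
  A := {0, 1, 2, 3}
  A_zero := by decide
  A_pref := by decide
  c_pref := by decide
  A_ap := by decide

/-- Index of an edge: depth of its upper end. -/
noncomputable def edgeIdx {V : Type} (G : SimpleGraph V) (r : V) : Sym2 V → ℕ :=
  Sym2.lift ⟨fun u v => min (G.dist r u) (G.dist r v), fun _ _ => min_comm _ _⟩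

theorem edgeIdx_mk {V : Type} (G : SimpleGraph V) (r u v : V) :
    edgeIdx G r s(u, v) = min (G.dist r u) (G.dist r v) := rfl

theorem adj_depth {V : Type} {G : SimpleGraph V} (hG : G.IsTree) (r : V) {u v : V}
    (h : G.Adj u v) : G.dist r u = G.dist r v + 1 ∨ G.dist r v = G.dist r u + 1 := by
  have h1 := hG.dist_ne_of_adj r h
  have h2 := hG.connected.dist_triangle (u := r) (v := u) (w := v)
  have h3 := hG.connected.dist_triangle (u := r) (v := v) (w := u)
  rw [SimpleGraph.dist_eq_one_iff_adj.2 h] at h2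
  rw [SimpleGraph.dist_eq_one_iff_adj.2 h.symm] at h3
  omega

theorem parent_unique {V : Type} {G : SimpleGraph V} (hG : G.IsTree) (r : V) {x y u : V}
    (hx : G.Adj x u) (hy : G.Adj y u) (hdx : G.dist r u = G.dist r x + 1)
    (hdy : G.dist r u = G.dist r y + 1) : x = y := by
  obtain ⟨p, hp⟩ := hG.connected.exists_walk_length_eq_dist r x
  obtain ⟨q, hq⟩ := hG.connected.exists_walk_length_eq_dist r y
  have h1 : (p.concat hx).IsPath :=
    SimpleGraph.Walk.isPath_of_length_eq_dist _ (by simp [hp, hdx])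
  have h2 : (q.concat hy).IsPath :=
    SimpleGraph.Walk.isPath_of_length_eq_dist _ (by simp [hq, hdy])
  have h3 : p.concat hx = q.concat hy := (hG.existsUnique_path r u).unique h1 h2
  have := congrArg SimpleGraph.Walk.penultimate h3
  simpa using this

theorem path_idx {V : Type} {G : SimpleGraph V} (hG : G.IsTree) (r : V) {u v : V}
    (p : G.Walk u v) (hp : p.IsPath) : ∃ m a b, G.dist r u = m + a ∧ G.dist r v = m + b ∧
      p.edges.map (edgeIdx G r) = (List.range' m a).reverse ++ List.range' m b := by
  induction p with
  | nil => exact ⟨_, 0, 0, rfl, rfl, by simp⟩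
  | @cons u u' v h p ih =>
    rw [SimpleGraph.Walk.cons_isPath_iff] at hp
    obtain ⟨m, a, b, hu, hv, he⟩ := ih hp.1
    rw [SimpleGraph.Walk.edges_cons, List.map_cons, he, edgeIdx_mk]
    rcases adj_depth hG r h with h1 | h1
    · refine ⟨m, a + 1, b, by omega, hv, ?_⟩
      rw [List.range'_concat, List.reverse_append]
      simp
      omega
    · cases a with
      | zero =>
        refine ⟨G.dist r u, 0, b + 1, by omega, by omega, ?_⟩
        have : m = G.dist r u + 1 := by omega
        subst this
        simp [List.range'_succ, h1]
      | succ a =>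
        exfalso
        cases p with
        | nil => simp [List.range'_concat] at he
        | @cons _ u'' _ h' p' =>
          rw [SimpleGraph.Walk.edges_cons, List.map_cons, edgeIdx_mk, List.range'_concat,
            List.reverse_append] at he
          simp at he
          have h2 := he.1
          have h3 : G.dist r u' = G.dist r u'' + 1 := by
            rcases adj_depth hG r h' with h3 | h3 <;> omega
          have : u = u'' := parent_unique hG r h h'.symm h1 h3
          apply hp.2
          rw [this]
          simp

theorem map_range'_infix {α : Type} (l : List α) (x : α) (m b : ℕ) (h : m + b ≤ l.length) :
    (List.range' m b).map (fun i => l.getD i x) <:+: l := by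
  have : (List.range' m b).map (fun i => l.getD i x) = (l.drop m).take b := by
    apply List.ext_getElem
    · simp; omega
    · intro i h1 h2
      simp at h1
      simp
      rw [List.getElem?_eq_getElem (by omega)]
      simp
  rw [this]
  exact (List.take_prefix _ _).isInfix.trans (List.drop_suffix _ _).isInfix

theorem tree_colouring {V : Type} [Finite V] {G : SimpleGraph V} (hG : G.IsTree) {α : Type}
    [DecidableEq α] (x : α) (k : ℕ) (hw : ∀ N, ∃ l : List α, N < l.length ∧ ¬ HasAP k l) :
    ∃ f : Sym2 V → α, KAnagramFreeEC (k + k) G f := by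
  obtain ⟨r⟩ := hG.connected.nonempty
  obtain ⟨N, hN⟩ := (Set.finite_range (G.dist r)).bddAbove
  obtain ⟨l, hl, hn⟩ := hw N
  have hb : ∀ v, G.dist r v ≤ N := fun v => hN ⟨v, rfl⟩
  refine ⟨(fun i => l.getD i x) ∘ edgeIdx G r, ?_⟩
  intro u v p hp hk
  obtain ⟨m, a, b, hu, hv, he⟩ := path_idx hG r p hp
  have hu' := hb u
  have hv' := hb v
  rw [← List.map_map, he, List.map_append, List.map_reverse] at hk
  rcases isKAnagram_split hk with ⟨w, hw, hi⟩ | ⟨w, hw, hi⟩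
  · apply hn
    refine hasAP_of_infix (isKAnagram_reverse hw) (List.IsInfix.trans ?_
      (map_range'_infix l x m a (by omega)))
    rw [← List.reverse_infix, List.reverse_reverse]
    exact hi
  · exact hn (hasAP_of_infix hw (hi.trans (map_range'_infix l x m b (by omega))))

/-- Every tree has a `6`-anagram-free edge colouring with
`3` colours and an `8`-anagram-free edge colouring with `2` colours:
`φ'₆(T) ≤ 3` and `φ'₈(T) ≤ 2`. -/
theorem sixAnagram_three_and_eightAnagram_two_edge_of_tree {V : Type} [Finite V]
    (G : SimpleGraph V) (hG : G.IsTree) :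
    (∃ f : Sym2 V → Fin 3, KAnagramFreeEC 6 G f) ∧
    (∃ f : Sym2 V → Fin 2, KAnagramFreeEC 8 G f) := by
  exact ⟨tree_colouring hG 0 3 (dekking3.long (by omega) (by decide) 0),
    tree_colouring hG 0 4 (dekking2.long (by omega) (by decide) 0)⟩
end
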